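/- arXiv:1905.09249 — 2 statements merged into one kernel-verified Lean document; each statement's English description precedes it below -/
import Mathlib

section
/- If f is a Schwartz function on ℝⁿ, then the function g = 2^{n/2} (f * e^{-2π|·|²}) (the convolution of f with the Gaussian e^{-2π|x|²}) belongs to the Gevrey class G^{1/2}(ℝⁿ): there exist K > 0 and C > 0 such that |∂_x^α g(x)| ≤ K C^{|α|} (|α|!)^{1/2} for all multi-indices α and all x ∈ ℝⁿ. -/
open Real MeasureTheory

/-- Partial derivative in the `i`-th coordinate direction. -/
noncomputable def pderiv' {n : ℕ} (i : Fin n) (f : (Fin n → ℝ) → ℝ) : (Fin n → ℝ) → ℝ :=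
  fun x => fderiv ℝ f x (Pi.single i 1)

/-- Iterated mixed partial derivative along a list of coordinate directions; the
multi-index `α` corresponds to the multiplicities `l.count i`, and `|α| = l.length`. -/
noncomputable def pderivList {n : ℕ} : List (Fin n) → ((Fin n → ℝ) → ℝ) → ((Fin n → ℝ) → ℝ)
  | [], f => f
  | i :: l, f => pderiv' i (pderivList l f)

/-- The frequency weight. -/
noncomputable def wt {n : ℕ} (f : SchwartzMap (Fin n → ℝ) ℝ) (l : List (Fin n))
    (p : (Fin n → ℝ) × (Fin n → ℝ)) : ℝ :=
  f p.1 * Real.exp (-(8 * π)⁻¹ * ∑ i, p.2 i ^ 2) * (l.map p.2).prod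

theorem gauss_int (n : ℕ) {b : ℝ} (hb : 0 < b) :
    Integrable (fun v : Fin n → ℝ => Real.exp (-b * ∑ i, v i ^ 2)) := by
  have h := (GaussianFourier.integrable_cexp_neg_mul_sum_add (ι := Fin n) (b := (b : ℂ))
    (by simpa using hb) 0).norm
  refine h.congr (Filter.Eventually.of_forall fun v => ?_)
  simp only [Complex.norm_exp]
  congr 1
  have : (-(b:ℂ) * ∑ i, (v i : ℂ) ^ 2 + ∑ i, (0 : Fin n → ℂ) i * v i)
    = ((-b * ∑ i, v i ^ 2 : ℝ) : ℂ) := by simp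
  rw [this, Complex.ofReal_re]

theorem gauss_cos (n : ℕ) (t : Fin n → ℝ) :
    ∫ v : Fin n → ℝ, Real.exp (-(8 * π)⁻¹ * ∑ i, v i ^ 2) * Real.cos (∑ i, v i * t i)
      = (8 * π ^ 2) ^ ((n : ℝ) / 2) * Real.exp (-2 * π * ∑ i, t i ^ 2) := by
  have hb : 0 < (((8 * π)⁻¹ : ℝ) : ℂ).re := by
    rw [Complex.ofReal_re]; positivity
  have h := GaussianFourier.integral_cexp_neg_mul_sum_add (ι := Fin n) hb
    (fun i => Complex.I * t i)
  have hi := GaussianFourier.integrable_cexp_neg_mul_sum_add (ι := Fin n) hb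
    (fun i => Complex.I * t i)
  have h2 := congrArg Complex.re h
  have h3 := integral_re hi
  simp only [RCLike.re_to_complex] at h3
  rw [← h3] at h2
  convert h2 using 1
  · refine integral_congr_ae (Filter.Eventually.of_forall fun v => ?_)
    have : (-(((8 * π)⁻¹ : ℝ) : ℂ) * ∑ i, (v i : ℂ) ^ 2 + ∑ i, Complex.I * t i * v i)
      = ((-(8 * π)⁻¹ * ∑ i, v i ^ 2 : ℝ) : ℂ) + ((∑ i, v i * t i : ℝ) : ℂ) * Complex.I := by
      push_cast
      rw [Finset.sum_mul]
      congr 1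
      exact Finset.sum_congr rfl fun i _ => by ring
    simp only [this, Complex.exp_re, Complex.add_re, Complex.add_im, Complex.re_ofReal_mul,
      Complex.im_ofReal_mul, Complex.ofReal_re, Complex.ofReal_im, Complex.I_re, Complex.I_im,
      mul_zero, add_zero, mul_one, zero_add]
  · have e1 : ((π : ℂ) / (((8 * π)⁻¹ : ℝ) : ℂ)) ^ ((Fintype.card (Fin n) : ℂ) / 2)
      = (((8 * π ^ 2) ^ ((n : ℝ) / 2) : ℝ) : ℂ) := by
      rw [Complex.ofReal_cpow (by positivity)]
      congr 1
      · push_cast; field_simp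
      · simp
    have e2 : (∑ i, (Complex.I * (t i : ℂ)) ^ 2) / (4 * (((8 * π)⁻¹ : ℝ) : ℂ))
      = ((-2 * π * ∑ i, t i ^ 2 : ℝ) : ℂ) := by
      simp only [mul_pow, Complex.I_sq, ← Finset.mul_sum]
      push_cast
      have : (π : ℂ) ≠ 0 := by exact_mod_cast Real.pi_ne_zero
      field_simp
      ring
    rw [e1, e2, ← Complex.ofReal_exp, ← Complex.ofReal_mul, Complex.ofReal_re]

theorem prod_abs_le {n : ℕ} (l : List (Fin n)) (v : Fin n → ℝ) :
    |(l.map v).prod| ≤ √(∑ i, v i ^ 2) ^ l.length := by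
  induction l with
  | nil => simp
  | cons i l ih =>
    simp only [List.map_cons, List.prod_cons, abs_mul, List.length_cons]
    rw [pow_succ']
    gcongr
    apply Real.abs_le_sqrt
    exact Finset.single_le_sum (f := fun i => v i ^ 2) (fun i _ => sq_nonneg _) (Finset.mem_univ i)

theorem pow_exp_le {b : ℝ} (hb : 0 < b) (k : ℕ) (s : ℝ) (hs : 0 ≤ s) :
    √s ^ k * Real.exp (-b * s) ≤
      Real.exp (-(b / 2) * s) * ((√b)⁻¹ ^ k * (k.factorial : ℝ) ^ ((1 : ℝ) / 2)) := by
  have h := Real.pow_div_factorial_le_exp (b * s) (by positivity) k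
  have hk : (0 : ℝ) < k.factorial := by positivity
  rw [div_le_iff₀ hk] at h
  have h2 := Real.sqrt_le_sqrt h
  rw [← Real.sqrt_eq_rpow, Real.sqrt_mul (by positivity), ← Real.exp_half,
    mul_pow, Real.sqrt_mul (by positivity)] at *
  have e : ∀ a : ℝ, 0 ≤ a → √(a ^ k) = √a ^ k := fun a ha => by
    rw [Real.sqrt_eq_iff_mul_self_eq (by positivity) (by positivity), ← mul_pow,
      Real.mul_self_sqrt ha]
  rw [e _ hb.le, e _ hs] at h2
  have hbk : 0 < √b ^ k := by positivity
  have h3 : √s ^ k ≤ Real.exp (b * s / 2) * √(k.factorial) * (√b)⁻¹ ^ k := by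
    rw [inv_pow, ← div_eq_mul_inv, le_div_iff₀ hbk]
    linarith
  have h4 : Real.exp (-(b / 2) * s) = Real.exp (b * s / 2) * Real.exp (-b * s) := by
    rw [← Real.exp_add]; congr 1; ring
  rw [h4]
  have := mul_le_mul_of_nonneg_right h3 (Real.exp_pos (-b * s)).le
  linarith

theorem wt_le {n : ℕ} (f : SchwartzMap (Fin n → ℝ) ℝ) (l : List (Fin n))
    (p : (Fin n → ℝ) × (Fin n → ℝ)) :
    |wt f l p| ≤ |f p.1| * Real.exp (-((8 * π)⁻¹ / 2) * ∑ i, p.2 i ^ 2) *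
      ((√(8 * π)⁻¹)⁻¹ ^ l.length * (l.length.factorial : ℝ) ^ ((1 : ℝ) / 2)) := by
  have h1 := prod_abs_le l p.2
  have h2 := pow_exp_le (b := (8 * π)⁻¹) (by positivity) l.length (∑ i, p.2 i ^ 2)
    (Finset.sum_nonneg fun i _ => sq_nonneg _)
  rw [wt, abs_mul, abs_mul, Real.abs_exp, mul_assoc, mul_assoc]
  refine mul_le_mul_of_nonneg_left (le_trans ?_ h2) (abs_nonneg _)
  rw [mul_comm]
  exact mul_le_mul_of_nonneg_right h1 (Real.exp_pos _).le

theorem dom_int {n : ℕ} (f : SchwartzMap (Fin n → ℝ) ℝ) :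
    Integrable (fun p : (Fin n → ℝ) × (Fin n → ℝ) =>
      |f p.1| * Real.exp (-((8 * π)⁻¹ / 2) * ∑ i, p.2 i ^ 2)) := by
  have hf : Integrable (fun y => |f y|) := f.integrable.abs
  exact hf.mul_prod (gauss_int n (b := (8 * π)⁻¹ / 2) (by positivity))

theorem wt_cont {n : ℕ} (f : SchwartzMap (Fin n → ℝ) ℝ) (l : List (Fin n)) :
    Continuous (wt f l) := by
  have hf : Continuous f := f.continuous
  have : Continuous fun p : (Fin n → ℝ) × (Fin n → ℝ) => (l.map p.2).prod := by
    induction l with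
    | nil => simpa using continuous_const
    | cons i l ih =>
      simp only [List.map_cons, List.prod_cons]
      fun_prop
  unfold wt
  fun_prop

theorem wt_int {n : ℕ} (f : SchwartzMap (Fin n → ℝ) ℝ) (l : List (Fin n)) :
    Integrable (wt f l) := by
  refine ((dom_int f).mul_const _).mono' (wt_cont f l).aestronglyMeasurable
    (Filter.Eventually.of_forall fun p => wt_le f l p)

/-- The integral representing the derivative of order `l`. -/
noncomputable def rep {n : ℕ} (f : SchwartzMap (Fin n → ℝ) ℝ) (l : List (Fin n))
    (x : Fin n → ℝ) : ℝ :=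
  ∫ p : (Fin n → ℝ) × (Fin n → ℝ),
    wt f l p * Real.cos (∑ i, p.2 i * (x i - p.1 i) + l.length * (π / 2))

theorem rep_int {n : ℕ} (f : SchwartzMap (Fin n → ℝ) ℝ) (l : List (Fin n))
    (x : Fin n → ℝ) : Integrable (fun p : (Fin n → ℝ) × (Fin n → ℝ) =>
    wt f l p * Real.cos (∑ i, p.2 i * (x i - p.1 i) + l.length * (π / 2))) := by
  have := wt_cont f l
  refine (wt_int f l).abs.mono' (Continuous.aestronglyMeasurable (by fun_prop))
    (Filter.Eventually.of_forall fun p => ?_)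
  rw [Real.norm_eq_abs, abs_mul]
  exact mul_le_of_le_one_right (abs_nonneg _) (Real.abs_cos_le_one _)

theorem rep_deriv {n : ℕ} (f : SchwartzMap (Fin n → ℝ) ℝ) (l : List (Fin n)) (j : Fin n)
    (c : ℝ) : pderiv' j (fun x => c * rep f l x) = fun x => c * rep f (j :: l) x := by
  funext x
  let L : (Fin n → ℝ) → ((Fin n → ℝ) →L[ℝ] ℝ) :=
    fun v => ∑ i, v i • (ContinuousLinearMap.proj i : (Fin n → ℝ) →L[ℝ] ℝ)
  have hLc : Continuous L := by
    unfold L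
    fun_prop
  let F' : (Fin n → ℝ) → (Fin n → ℝ) × (Fin n → ℝ) → ((Fin n → ℝ) →L[ℝ] ℝ) := fun x p =>
    (wt f l p * -Real.sin (∑ i, p.2 i * (x i - p.1 i) + l.length * (π / 2))) • L p.2
  have hwc := wt_cont f l
  have hbound : ∀ x p, ‖F' x p‖ ≤ ∑ i, |wt f (i :: l) p| := by
    intro x p
    have h1 : ‖L p.2‖ ≤ ∑ i, |p.2 i| := by
      refine (norm_sum_le _ _).trans (Finset.sum_le_sum fun i _ => ?_)
      rw [norm_smul, Real.norm_eq_abs]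
      refine mul_le_of_le_one_right (abs_nonneg _) ?_
      refine ContinuousLinearMap.opNorm_le_bound _ zero_le_one fun v => ?_
      simpa using norm_le_pi_norm v i
    have h2 : ∑ i, |wt f (i :: l) p| = |wt f l p| * ∑ i, |p.2 i| := by
      rw [Finset.mul_sum]
      refine Finset.sum_congr rfl fun i _ => ?_
      rw [← abs_mul]; congr 1
      simp only [wt, List.map_cons, List.prod_cons]; ring
    rw [h2, norm_smul, norm_mul, norm_neg, Real.norm_eq_abs, Real.norm_eq_abs]
    refine mul_le_mul ?_ h1 (norm_nonneg _) (abs_nonneg _)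
    exact mul_le_of_le_one_right (abs_nonneg _) (Real.abs_sin_le_one _)
  have hbi : Integrable (fun p => ∑ i, |wt f (i :: l) p|) :=
    integrable_finsetSum _ fun i _ => (wt_int f (i :: l)).abs
  have hF'c : AEStronglyMeasurable (F' x) volume := by
    refine Continuous.aestronglyMeasurable ?_
    unfold F'
    fun_prop
  have key : HasFDerivAt (rep f l) (∫ p, F' x p) x := by
    refine hasFDerivAt_integral_of_dominated_of_fderiv_le (s := Set.univ) (F' := F')
      Filter.univ_mem ?_ (rep_int f l x) hF'c
      (Filter.Eventually.of_forall fun p x _ => hbound x p) hbi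
      (Filter.Eventually.of_forall fun p x _ => ?_)
    · exact Filter.Eventually.of_forall fun x => (rep_int f l x).aestronglyMeasurable
    · have h1 : HasFDerivAt (fun x : Fin n → ℝ =>
          ∑ i, p.2 i * (x i - p.1 i) + l.length * (π / 2)) (L p.2) x := by
        refine HasFDerivAt.add_const _ ?_
        refine HasFDerivAt.fun_sum fun i _ => ?_
        exact ((hasFDerivAt_apply i x).sub_const _).const_mul _
      have h2 := (h1.cos).const_mul (wt f l p)
      rw [smul_smul] at h2
      exact h2
  have hint : Integrable (F' x) := hbi.mono' hF'c (Filter.Eventually.of_forall fun p => hbound x p)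
  have hk := key.const_mul c
  rw [pderiv', hk.fderiv]
  rw [ContinuousLinearMap.smul_apply, smul_eq_mul, ContinuousLinearMap.integral_apply hint, rep]
  congr 1
  refine integral_congr_ae (Filter.Eventually.of_forall fun p => ?_)
  have hL : L p.2 (Pi.single j 1) = p.2 j := by
    simp [L, ContinuousLinearMap.sum_apply, Pi.single_apply]
  simp only [F', ContinuousLinearMap.smul_apply, hL, smul_eq_mul, List.length_cons]
  have : ∀ a : ℝ, a + ((l.length + 1 : ℕ) : ℝ) * (π / 2) = (a + l.length * (π / 2)) + π / 2 := by
    intro a; push_cast; ring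
  rw [this, Real.cos_add_pi_div_two]
  simp only [wt, List.map_cons, List.prod_cons]; ring

theorem rep_list {n : ℕ} (f : SchwartzMap (Fin n → ℝ) ℝ) (c : ℝ) (l : List (Fin n)) :
    pderivList l (fun x => c * rep f [] x) = fun x => c * rep f l x := by
  induction l with
  | nil => rfl
  | cons j l ih => rw [pderivList, ih, rep_deriv]

theorem rep_nil {n : ℕ} (f : SchwartzMap (Fin n → ℝ) ℝ) (x : Fin n → ℝ) :
    rep f [] x = (8 * π ^ 2) ^ ((n : ℝ) / 2) *
      ∫ y : Fin n → ℝ, f y * Real.exp (-2 * Real.pi * ∑ i, (x i - y i) ^ 2) := by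
  have hi := rep_int f [] x
  rw [rep]
  rw [Measure.volume_eq_prod] at hi ⊢
  rw [integral_prod _ hi, ← integral_const_mul]
  refine integral_congr_ae (Filter.Eventually.of_forall fun y => ?_)
  have := gauss_cos n (fun i => x i - y i)
  simp only [wt, List.map_nil, List.prod_nil, mul_one, List.length_nil, Nat.cast_zero, zero_mul,
    add_zero, mul_assoc (f y), integral_const_mul]
  rw [this]; ring

theorem heat_of_schwartz_is_gevrey_half (n : ℕ) (f : SchwartzMap (Fin n → ℝ) ℝ) :
    ∃ K > (0 : ℝ), ∃ C > (0 : ℝ), ∀ (l : List (Fin n)) (x : Fin n → ℝ),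
      |pderivList l
          (fun x : Fin n → ℝ =>
            (2 : ℝ) ^ ((n : ℝ) / 2) *
              ∫ y : Fin n → ℝ, f y * Real.exp (-2 * Real.pi * ∑ i, (x i - y i) ^ 2)) x| ≤
        K * C ^ l.length * (Nat.factorial l.length : ℝ) ^ ((1 : ℝ) / 2) := by
  obtain ⟨c, hc⟩ : ∃ c : ℝ, c = (2 : ℝ) ^ ((n : ℝ) / 2) * ((8 * π ^ 2) ^ ((n : ℝ) / 2))⁻¹ :=
    ⟨_, rfl⟩
  have hg : (fun x : Fin n → ℝ => (2 : ℝ) ^ ((n : ℝ) / 2) *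
      ∫ y : Fin n → ℝ, f y * Real.exp (-2 * Real.pi * ∑ i, (x i - y i) ^ 2))
      = fun x => c * rep f [] x := by
    funext x
    have : ((8 * π ^ 2) ^ ((n : ℝ) / 2) : ℝ) ≠ 0 := by positivity
    rw [rep_nil, hc]
    field_simp
  have hM : 0 ≤ ∫ p : (Fin n → ℝ) × (Fin n → ℝ),
      |f p.1| * Real.exp (-((8 * π)⁻¹ / 2) * ∑ i, p.2 i ^ 2) :=
    integral_nonneg fun p => by positivity
  have hc0 : 0 < c := by rw [hc]; positivity
  refine ⟨c * (∫ p : (Fin n → ℝ) × (Fin n → ℝ),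
      |f p.1| * Real.exp (-((8 * π)⁻¹ / 2) * ∑ i, p.2 i ^ 2)) + 1, by positivity,
      (√(8 * π)⁻¹)⁻¹, by positivity, fun l x => ?_⟩
  rw [hg, rep_list, abs_mul, abs_of_pos hc0]
  have h1 : |rep f l x| ≤ (∫ p : (Fin n → ℝ) × (Fin n → ℝ),
      |f p.1| * Real.exp (-((8 * π)⁻¹ / 2) * ∑ i, p.2 i ^ 2)) *
      ((√(8 * π)⁻¹)⁻¹ ^ l.length * (l.length.factorial : ℝ) ^ ((1 : ℝ) / 2)) := by
    rw [← integral_mul_const, ← Real.norm_eq_abs]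
    refine norm_integral_le_of_norm_le ((dom_int f).mul_const _)
      (Filter.Eventually.of_forall fun p => ?_)
    rw [Real.norm_eq_abs, abs_mul]
    exact (mul_le_of_le_one_right (abs_nonneg _) (Real.abs_cos_le_one _)).trans (wt_le f l p)
  have h2 := mul_le_mul_of_nonneg_left h1 hc0.le
  have h3 : 0 ≤ (√(8 * π)⁻¹)⁻¹ ^ l.length * (l.length.factorial : ℝ) ^ ((1 : ℝ) / 2) := by
    positivity
  linarith
end

section
/- Let λ > 0 and 0 < μ < 1/2. Then every function in the Gelfand–Shilov space S(λ,μ)(ℝⁿ) lies in the image of the Schwartz space 𝒮(ℝⁿ) under the heat operator e^{(1/(8π))Δ}, i.e., for every v ∈ S(λ,μ)(ℝⁿ) there exists Φ ∈ 𝒮(ℝⁿ) with v = 2^{n/2} Φ * e^{-2π|·|²}. -/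
open Real MeasureTheory

section helpers
open SchwartzMap LineDeriv Laplacian FourierTransform Filter Topology

theorem gs_pderiv_smooth {n : ℕ} (i : Fin n) {f : (Fin n → ℝ) → ℝ}
    (hf : ContDiff ℝ (⊤ : ℕ∞) f) : ContDiff ℝ (⊤ : ℕ∞) (pderiv' i f) := by
  unfold pderiv'
  exact (hf.fderiv_right (m := (⊤ : ℕ∞)) (by simp)).clm_apply contDiff_const

theorem gs_iteratedFDeriv_single {n : ℕ} {f : (Fin n → ℝ) → ℝ}
    (hf : ContDiff ℝ (⊤ : ℕ∞) f) (j : ℕ) : ∀ (s : Fin j → Fin n) (x : Fin n → ℝ),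
    iteratedFDeriv ℝ j f x (fun i => Pi.single (s i) (1 : ℝ)) = pderivList (List.ofFn s) f x := by
  induction j with
  | zero => intro s x; simp [pderivList]
  | succ j ih =>
    intro s x
    rw [DifferentiableAt.iteratedFDeriv_succ_apply_left']
    · rw [List.ofFn_succ]
      simp only [pderivList, pderiv']
      congr 2
      funext y
      exact ih (fun i => s i.succ) y
    · exact (hf.differentiable_iteratedFDeriv (mod_cast ENat.natCast_lt_top j)) x

theorem gs_norm_iteratedFDeriv_le {n : ℕ} {f : (Fin n → ℝ) → ℝ}
    (hf : ContDiff ℝ (⊤ : ℕ∞) f) (j : ℕ) (x : Fin n → ℝ) :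
    ‖iteratedFDeriv ℝ j f x‖ ≤ ∑ s : Fin j → Fin n, |pderivList (List.ofFn s) f x| := by
  refine ContinuousMultilinearMap.opNorm_le_bound (Finset.sum_nonneg fun _ _ => abs_nonneg _) ?_
  intro m
  have hm : m = fun i => ∑ k : Fin n, (m i k) • (Pi.single k (1 : ℝ) : Fin n → ℝ) := by
    funext i
    exact pi_eq_sum_univ' (m i)
  conv_lhs => rw [hm]
  rw [ContinuousMultilinearMap.map_sum, Finset.sum_mul]
  refine (norm_sum_le _ _).trans (Finset.sum_le_sum fun s _ => ?_)
  rw [ContinuousMultilinearMap.map_smul_univ, gs_iteratedFDeriv_single hf, norm_smul, norm_prod,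
    mul_comm, Real.norm_eq_abs]
  gcongr with i
  exact norm_le_pi_norm (m i) (s i)

theorem gs_decay_of_bound {n : ℕ} {f : (Fin n → ℝ) → ℝ}
    (hf : ContDiff ℝ (⊤ : ℕ∞) f) (m j : ℕ) (M : ℝ)
    (h0 : ∀ (l : List (Fin n)) x, l.length = j → |pderivList l f x| ≤ M)
    (h1 : ∀ (l : List (Fin n)) (i : Fin n) x, l.length = j → |x i ^ m * pderivList l f x| ≤ M)
    (x : Fin n → ℝ) : ‖x‖ ^ m * ‖iteratedFDeriv ℝ j f x‖ ≤ (n : ℝ) ^ j * M := by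
  have key : ∀ l : List (Fin n), l.length = j → ‖x‖ ^ m * |pderivList l f x| ≤ M := by
    intro l hl
    rcases isEmpty_or_nonempty (Fin n) with h | h
    · have hx : ‖x‖ = 0 := by
        rw [Subsingleton.elim x 0]; simp
      calc ‖x‖ ^ m * |pderivList l f x| ≤ 1 * |pderivList l f x| := by
            gcongr
            rw [hx]; exact pow_le_one₀ le_rfl zero_le_one
        _ ≤ M := by simpa using h0 l x hl
    · obtain ⟨i, -, hi⟩ := Finset.exists_mem_eq_sup (Finset.univ : Finset (Fin n))
        Finset.univ_nonempty (fun b => ‖x b‖₊)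
      have : ‖x‖ = |x i| := by
        rw [Pi.norm_def, hi]; rfl
      rw [this, ← abs_pow, ← abs_mul]
      exact h1 l i x hl
  calc ‖x‖ ^ m * ‖iteratedFDeriv ℝ j f x‖
      ≤ ‖x‖ ^ m * ∑ s : Fin j → Fin n, |pderivList (List.ofFn s) f x| := by
        gcongr; exact gs_norm_iteratedFDeriv_le hf j x
    _ = ∑ s : Fin j → Fin n, ‖x‖ ^ m * |pderivList (List.ofFn s) f x| := Finset.mul_sum _ _ _
    _ ≤ ∑ s : Fin j → Fin n, M := Finset.sum_le_sum fun s _ => key _ (by simp)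
    _ = (n : ℝ) ^ j * M := by simp

theorem gs_pderivList_append {n : ℕ} (l l' : List (Fin n)) (f : (Fin n → ℝ) → ℝ) :
    pderivList (l ++ l') f = pderivList l (pderivList l' f) := by
  induction l with
  | nil => rfl
  | cons a l ih => simp [pderivList, ih]

/-- Coordinate Laplacian on Schwartz functions on `Fin n → ℝ`. -/
noncomputable def gsLap {n : ℕ} (f : SchwartzMap (Fin n → ℝ) ℝ) : SchwartzMap (Fin n → ℝ) ℝ :=
  ∑ i : Fin n, ∂_{(Pi.single i (1 : ℝ) : Fin n → ℝ)} (∂_{(Pi.single i (1 : ℝ) : Fin n → ℝ)} f)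

theorem gs_coe_lineDeriv {n : ℕ} (i : Fin n) (f : SchwartzMap (Fin n → ℝ) ℝ) :
    ⇑(∂_{(Pi.single i (1 : ℝ) : Fin n → ℝ)} f : SchwartzMap (Fin n → ℝ) ℝ) = pderiv' i f := by
  funext x
  rw [SchwartzMap.lineDerivOp_apply_eq_fderiv]; rfl

/-- Iterated partial derivatives of a Schwartz function. -/
noncomputable def gsP {n : ℕ} : List (Fin n) → SchwartzMap (Fin n → ℝ) ℝ →
    SchwartzMap (Fin n → ℝ) ℝ
  | [], f => f
  | i :: l, f => ∂_{(Pi.single i (1 : ℝ) : Fin n → ℝ)} (gsP l f)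

theorem gs_coe_P {n : ℕ} (l : List (Fin n)) (f : SchwartzMap (Fin n → ℝ) ℝ) :
    ⇑(gsP l f) = pderivList l f := by
  induction l with
  | nil => rfl
  | cons a l ih => rw [gsP, gs_coe_lineDeriv, ih]; rfl

theorem gs_P_sum {n : ℕ} (l : List (Fin n)) (g : Fin n → SchwartzMap (Fin n → ℝ) ℝ) :
    gsP l (∑ i, g i) = ∑ i, gsP l (g i) := by
  induction l with
  | nil => rfl
  | cons a l ih => simp only [gsP, ih, lineDerivOp_sum]

theorem gs_pderivList_lap {n : ℕ} (l : List (Fin n)) (f : SchwartzMap (Fin n → ℝ) ℝ)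
    (x : Fin n → ℝ) :
    pderivList l (gsLap f) x = ∑ i, pderivList (l ++ [i, i]) f x := by
  rw [← gs_coe_P, gsLap, gs_P_sum, _root_.sum_apply]
  refine Finset.sum_congr rfl fun i _ => ?_
  rw [gs_coe_P, gs_pderivList_append, gs_coe_lineDeriv, gs_coe_lineDeriv]
  rfl

theorem gs_lap_bound {n : ℕ} (f : SchwartzMap (Fin n → ℝ) ℝ) (α : Fin n → ℕ) (a A mu : ℝ)
    (h : ∀ (l : List (Fin n)) (x : Fin n → ℝ), |(∏ i, x i ^ α i) * pderivList l f x| ≤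
      a * A ^ l.length * ((Nat.factorial l.length : ℕ) : ℝ) ^ mu) (k : ℕ) :
    ∀ (l : List (Fin n)) (x : Fin n → ℝ), |(∏ i, x i ^ α i) * pderivList l (gsLap^[k] f) x| ≤
      (n : ℝ) ^ k * (a * A ^ (l.length + 2 * k) *
        ((Nat.factorial (l.length + 2 * k) : ℕ) : ℝ) ^ mu) := by
  induction k with
  | zero => intro l x; simpa using h l x
  | succ k ih =>
    intro l x
    rw [Function.iterate_succ_apply', gs_pderivList_lap, Finset.mul_sum]
    refine (Finset.abs_sum_le_sum_abs _ _).trans ?_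
    refine (Finset.sum_le_sum fun i _ => ih (l ++ [i, i]) x).trans (le_of_eq ?_)
    have : l.length + 2 + 2 * k = l.length + 2 * (k + 1) := by ring
    simp [this]
    ring

theorem gs_prod_factorial_le {n : ℕ} (l : List (Fin n)) :
    (∏ i, (Nat.factorial (l.count i) : ℝ)) ≤ ((Nat.factorial l.length : ℕ) : ℝ) := by
  have h := Nat.prod_factorial_dvd_factorial_sum (Finset.univ : Finset (Fin n)) (fun i => l.count i)
  have h2 : ∑ i : Fin n, l.count i = l.length := by
    have := Multiset.sum_count_eq_card (s := Finset.univ) (m := (l : Multiset (Fin n))) (by simp)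
    simpa using this
  rw [h2] at h
  exact_mod_cast Nat.le_of_dvd (Nat.factorial_pos _) h

theorem gs_summable (j : ℕ) (R mu : ℝ) (hR : 0 ≤ R) (hmu0 : 0 < mu) (hmu : mu < 1 / 2) :
    Summable (fun k : ℕ => R ^ k * ((Nat.factorial (j + 2 * k) : ℕ) : ℝ) ^ mu /
      (Nat.factorial k : ℝ)) := by
  have hlim : Tendsto (fun k : ℕ => R * ((j : ℝ) + 2) ^ (2 * mu) * ((k + 1 : ℕ) : ℝ) ^ (-(1 - 2 * mu)))
      atTop (𝓝 0) := by
    have h1 : Tendsto (fun x : ℝ => x ^ (-(1 - 2 * mu))) atTop (𝓝 0) :=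
      tendsto_rpow_neg_atTop (by linarith)
    have h2 := (h1.comp tendsto_natCast_atTop_atTop).comp (tendsto_add_atTop_nat 1)
    simpa using h2.const_mul (R * ((j : ℝ) + 2) ^ (2 * mu))
  refine summable_of_ratio_norm_eventually_le (r := 1 / 2) (by norm_num) ?_
  filter_upwards [hlim.eventually (ge_mem_nhds (show (0 : ℝ) < 1 / 2 by norm_num))] with k hk
  have hpos : ∀ k : ℕ, 0 ≤ R ^ k * ((Nat.factorial (j + 2 * k) : ℕ) : ℝ) ^ mu /
      (Nat.factorial k : ℝ) := fun k => by positivity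
  rw [Real.norm_of_nonneg (hpos _), Real.norm_of_nonneg (hpos _)]
  refine le_trans ?_ (mul_le_mul_of_nonneg_right hk (hpos k))
  have e1 : ((Nat.factorial (j + 2 * (k + 1)) : ℕ) : ℝ) =
      (((j : ℝ) + 2 * k + 2) * ((j : ℝ) + 2 * k + 1)) * ((Nat.factorial (j + 2 * k) : ℕ) : ℝ) := by
    have : j + 2 * (k + 1) = (j + 2 * k + 1) + 1 := by ring
    rw [this, Nat.factorial_succ, Nat.factorial_succ]
    push_cast; ring
  have e2 : (((j : ℝ) + 2 * k + 2) * ((j : ℝ) + 2 * k + 1)) ≤ (((j : ℝ) + 2) * (k + 1)) ^ 2 := by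
    have hj : (0 : ℝ) ≤ j := by positivity
    have hk : (0 : ℝ) ≤ k := by positivity
    have hjk := mul_nonneg hj hk
    rw [sq]
    apply mul_le_mul <;> nlinarith
  have e3 : (((j : ℝ) + 2 * k + 2) * ((j : ℝ) + 2 * k + 1)) ^ mu ≤
      ((j : ℝ) + 2) ^ (2 * mu) * ((k : ℝ) + 1) ^ (2 * mu) := by
    refine (Real.rpow_le_rpow (by positivity) e2 hmu0.le).trans (le_of_eq ?_)
    rw [← Real.mul_rpow (by positivity) (by positivity), Real.rpow_mul (by positivity)]
    norm_num
  have e4 : ((k + 1 : ℕ) : ℝ) ^ (-(1 - 2 * mu)) = ((k : ℝ) + 1) ^ (2 * mu) / ((k : ℝ) + 1) := by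
    push_cast
    rw [show -(1 - 2 * mu) = 2 * mu - 1 by ring, Real.rpow_sub (by positivity), Real.rpow_one]
  rw [e1, e4, Real.mul_rpow (by positivity) (by positivity), Nat.factorial_succ]
  push_cast
  calc R ^ (k + 1) * ((((j : ℝ) + 2 * k + 2) * ((j : ℝ) + 2 * k + 1)) ^ mu *
        ((Nat.factorial (j + 2 * k) : ℕ) : ℝ) ^ mu) / (((k : ℝ) + 1) * (Nat.factorial k : ℝ))
      ≤ R ^ (k + 1) * ((((j : ℝ) + 2) ^ (2 * mu) * ((k : ℝ) + 1) ^ (2 * mu)) *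
        ((Nat.factorial (j + 2 * k) : ℕ) : ℝ) ^ mu) / (((k : ℝ) + 1) * (Nat.factorial k : ℝ)) := by
        gcongr
    _ = _ := by
      field_simp
      ring

theorem gs_tsum_schwartz {D : Type*} [NormedAddCommGroup D] [NormedSpace ℝ D]
    (T : ℕ → SchwartzMap D ℝ) (b : ℕ → ℕ → ℕ → ℝ) (hb : ∀ m j, Summable (b m j))
    (h : ∀ m j k x, ‖x‖ ^ m * ‖iteratedFDeriv ℝ j (T k) x‖ ≤ b m j k) :
    ∃ Φ : SchwartzMap D ℝ, ∀ x, Φ x = ∑' k, T k x := by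
  have h0 : ∀ (j k : ℕ) (x : D), ((j : ℕ∞) ≤ ⊤) → ‖iteratedFDeriv ℝ j (T k) x‖ ≤ b 0 j k := by
    intro j k x _
    simpa using h 0 j k x
  have hs : ContDiff ℝ (⊤ : ℕ∞) (fun x => ∑' k, T k x) :=
    contDiff_tsum (v := fun j k => b 0 j k) (fun i => (T i).smooth ⊤) (fun k _ => hb 0 k) h0
  refine ⟨⟨fun x => ∑' k, T k x, hs, ?_⟩, fun x => rfl⟩
  intro m j
  refine ⟨∑' k, b m j k, fun x => ?_⟩
  rw [iteratedFDeriv_tsum_apply (N := ⊤) (fun i => (T i).smooth ⊤) (fun k _ => hb 0 k) h0 le_top]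
  have hsum : Summable fun k => ‖iteratedFDeriv ℝ j (T k) x‖ :=
    Summable.of_nonneg_of_le (fun _ => norm_nonneg _) (fun k => h0 j k x le_top) (hb 0 j)
  calc _ ≤ ‖x‖ ^ m * ∑' k, ‖iteratedFDeriv ℝ j (T k) x‖ := by
        gcongr; exact norm_tsum_le_tsum_norm hsum
    _ = ∑' k, ‖x‖ ^ m * ‖iteratedFDeriv ℝ j (T k) x‖ := tsum_mul_left.symm
    _ ≤ _ := (hsum.mul_left _).tsum_le_tsum (fun k => h m j k x) (hb m j)

abbrev GsE (n : ℕ) := EuclideanSpace ℝ (Fin n)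

/-- Transport of a real Schwartz function to a complex one on Euclidean space. -/
noncomputable def gsJ {n : ℕ} (f : SchwartzMap (Fin n → ℝ) ℝ) : SchwartzMap (GsE n) ℂ :=
  SchwartzMap.postcompCLM Complex.ofRealCLM
    (SchwartzMap.compCLMOfContinuousLinearEquiv ℝ (EuclideanSpace.equiv (Fin n) ℝ) f)

theorem gs_J_apply {n : ℕ} (f : SchwartzMap (Fin n → ℝ) ℝ) (x : GsE n) :
    gsJ f x = (f x.ofLp : ℂ) := by
  rw [gsJ, SchwartzMap.postcompCLM_apply, SchwartzMap.compCLMOfContinuousLinearEquiv_apply]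
  rfl

theorem gs_J_lineDeriv {n : ℕ} (f : SchwartzMap (Fin n → ℝ) ℝ) (i : Fin n) :
    ∂_{(EuclideanSpace.basisFun (Fin n) ℝ i)} (gsJ f) =
      gsJ (∂_{(Pi.single i (1 : ℝ) : Fin n → ℝ)} f) := by
  ext x
  rw [gs_J_apply, SchwartzMap.lineDerivOp_apply_eq_fderiv, SchwartzMap.lineDerivOp_apply_eq_fderiv]
  have h1 : HasFDerivAt (fun y : GsE n => (f y.ofLp : ℂ))
      (Complex.ofRealCLM.comp ((fderiv ℝ f x.ofLp).comp
        ((EuclideanSpace.equiv (Fin n) ℝ : GsE n ≃L[ℝ] (Fin n → ℝ)) : GsE n →L[ℝ] (Fin n → ℝ)))) x :=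
    Complex.ofRealCLM.hasFDerivAt.comp x ((f.hasFDerivAt x.ofLp).comp x
      (EuclideanSpace.equiv (Fin n) ℝ : GsE n ≃L[ℝ] (Fin n → ℝ)).hasFDerivAt)
  have h2 : ⇑(gsJ f) = fun y : GsE n => (f y.ofLp : ℂ) := funext (gs_J_apply f)
  rw [h2, h1.fderiv]
  simp
  rfl

theorem gs_J_lap {n : ℕ} (f : SchwartzMap (Fin n → ℝ) ℝ) : gsJ (gsLap f) = Δ (gsJ f) := by
  rw [SchwartzMap.laplacian_eq_sum (EuclideanSpace.basisFun (Fin n) ℝ)]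
  simp only [gs_J_lineDeriv]
  simp [gsJ, gsLap, map_sum]

theorem gs_fourier_lap {n : ℕ} (g : SchwartzMap (GsE n) ℂ) (ξ : GsE n) :
    𝓕 (Δ g) ξ = -(4 * (π : ℂ) ^ 2 * (‖ξ‖ : ℂ) ^ 2) * 𝓕 g ξ := by
  rw [SchwartzMap.laplacian_eq_fourierMultiplierCLM, SchwartzMap.fourierMultiplierCLM_apply,
    FourierTransform.fourier_smul, FourierTransform.fourier_fourierInv_eq, smul_apply,
    SchwartzMap.smulLeftCLM_apply_apply (by fun_prop)]
  simp [Complex.real_smul]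
  ring

theorem gs_fourier_lap_iter {n : ℕ} (f : SchwartzMap (Fin n → ℝ) ℝ) (k : ℕ) (ξ : GsE n) :
    𝓕 (gsJ (gsLap^[k] f)) ξ = (-(4 * (π : ℂ) ^ 2 * (‖ξ‖ : ℂ) ^ 2)) ^ k * 𝓕 (gsJ f) ξ := by
  induction k with
  | zero => simp
  | succ k ih => rw [Function.iterate_succ_apply', gs_J_lap, gs_fourier_lap, ih, pow_succ']; ring

theorem gs_gauss_norm {n : ℕ} (x ξ : GsE n) :
    ‖Complex.exp (-((π / 2 : ℝ) : ℂ) * (‖ξ‖ : ℂ) ^ 2 + 2 * π * Complex.I * (inner ℝ x ξ : ℝ))‖ =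
      Real.exp (-(π / 2) * ‖ξ‖ ^ 2) := by
  rw [Complex.norm_exp]
  congr 1
  simp [← Complex.ofReal_pow]

theorem gs_gauss_integrable {n : ℕ} {b : ℝ} (hb : 0 < b) :
    Integrable (fun ξ : GsE n => Real.exp (-b * ‖ξ‖ ^ 2)) := by
  have := (GaussianFourier.integrable_cexp_neg_mul_sq_norm_add (V := GsE n)
    (b := (b : ℂ)) (by simpa using hb) 0 0).norm
  refine this.congr (Eventually.of_forall fun ξ => ?_)
  simp [Complex.norm_exp, ← Complex.ofReal_pow]

theorem gs_heat_fourier {n : ℕ} (g : SchwartzMap (GsE n) ℂ) (x : GsE n) :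
    ∫ y : GsE n, g y * (((2 : ℝ) ^ ((n : ℝ) / 2) * Real.exp (-2 * π * ‖x - y‖ ^ 2) : ℝ) : ℂ) =
    ∫ ξ : GsE n, 𝓕 g ξ *
      Complex.exp (-((π / 2 : ℝ) : ℂ) * (‖ξ‖ : ℂ) ^ 2 + 2 * π * Complex.I * (inner ℝ x ξ : ℝ)) := by
  have hb : 0 < ((π / 2 : ℝ) : ℂ).re := by simp [Real.pi_pos]
  have hgint : Integrable (fun ξ : GsE n =>
      Complex.exp (-((π / 2 : ℝ) : ℂ) * (‖ξ‖ : ℂ) ^ 2 + 2 * π * Complex.I * (inner ℝ x ξ : ℝ))) :=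
    GaussianFourier.integrable_cexp_neg_mul_sq_norm_add hb (2 * π * Complex.I) x
  have h := VectorFourier.integral_fourierIntegral_smul_eq_flip (μ := volume) (ν := volume)
    (e := Real.fourierChar) (L := innerₗ (GsE n)) Real.continuous_fourierChar
    continuous_inner g.integrable hgint
  rw [flip_innerₗ] at h
  refine Eq.trans ?_ h.symm
  refine integral_congr_ae (Eventually.of_forall fun y => ?_)
  have h3 := fourier_gaussian_innerProductSpace' hb x y
  have h4 : VectorFourier.fourierIntegral Real.fourierChar volume (innerₗ (GsE n)) (fun ξ : GsE n =>
      Complex.exp (-((π / 2 : ℝ) : ℂ) * (‖ξ‖ : ℂ) ^ 2 + 2 * π * Complex.I * (inner ℝ x ξ : ℝ))) y =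
      (((2 : ℝ) ^ ((n : ℝ) / 2) * Real.exp (-2 * π * ‖x - y‖ ^ 2) : ℝ) : ℂ) := by
    refine Eq.trans h3 ?_
    have hpi : (π : ℂ) ≠ 0 := by exact_mod_cast Real.pi_ne_zero
    have e1 : (π : ℂ) / ((π / 2 : ℝ) : ℂ) = ((2 : ℝ) : ℂ) := by
      push_cast; field_simp
    have e2 : -(π : ℂ) ^ 2 * (‖x - y‖ : ℂ) ^ 2 / ((π / 2 : ℝ) : ℂ) =
        ((-2 * π * ‖x - y‖ ^ 2 : ℝ) : ℂ) := by
      push_cast; field_simp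
    rw [e1, e2, ← Complex.ofReal_exp, Complex.ofReal_mul ((2 : ℝ) ^ ((n : ℝ) / 2)),
      Complex.ofReal_cpow (by norm_num)]
    simp
  simp only [smul_eq_mul]
  rw [h4]

theorem gs_inversion {n : ℕ} (g : SchwartzMap (GsE n) ℂ) (x : GsE n) :
    ∫ ξ : GsE n, 𝓕 g ξ * Complex.exp (2 * π * Complex.I * (inner ℝ x ξ : ℝ)) = g x := by
  have h : 𝓕⁻ (𝓕 g) x = g x := by rw [FourierTransform.fourierInv_fourier_eq]
  rw [← h, SchwartzMap.fourierInv_coe, Real.fourierInv_eq']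
  refine integral_congr_ae (Eventually.of_forall fun ξ => ?_)
  simp only [smul_eq_mul, real_inner_comm x ξ]
  rw [mul_comm]
  congr 2
  push_cast
  ring

theorem gs_main {n : ℕ} (f : SchwartzMap (Fin n → ℝ) ℝ) (C : ℕ → ℝ) (hC : Summable C)
    (c : ℕ → ℝ) (hc : ∀ k, c k = (-(1 / (8 * π))) ^ k / (Nat.factorial k : ℝ))
    (hbd : ∀ k y, |c k * (gsLap^[k] f) y| ≤ C k) (x : Fin n → ℝ) :
    f x = (2 : ℝ) ^ ((n : ℝ) / 2) *
        ∫ y : Fin n → ℝ, (∑' k, c k * (gsLap^[k] f) y) *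
          Real.exp (-2 * Real.pi * ∑ i, (x i - y i) ^ 2) := by
  set X : GsE n := WithLp.toLp 2 x with hX
  set G : GsE n → ℝ := fun y => (2 : ℝ) ^ ((n : ℝ) / 2) * Real.exp (-2 * π * ‖X - y‖ ^ 2) with hG
  have hGint : Integrable G := by
    have := (gs_gauss_integrable (n := n) (b := 2 * π) (by positivity)).comp_sub_left X
    refine (this.const_mul ((2 : ℝ) ^ ((n : ℝ) / 2))).congr (Eventually.of_forall fun y => ?_)
    simp [hG]
  have hGc : Continuous G := by fun_prop
  have hG0 : ∀ y, 0 ≤ G y := fun y => by positivity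
  -- first exchange
  have hA : HasSum (fun k => ∫ y : GsE n, (c k : ℂ) * (gsJ (gsLap^[k] f) y * (G y : ℂ)))
      (∫ y : GsE n, (((∑' k, c k * (gsLap^[k] f) y.ofLp) * G y : ℝ) : ℂ)) := by
    refine hasSum_integral_of_dominated_convergence (fun k y => C k * G y) ?_ ?_ ?_ ?_ ?_
    · intro k
      have := (gsJ (gsLap^[k] f)).continuous
      exact Continuous.aestronglyMeasurable (by fun_prop)
    · intro k
      refine Eventually.of_forall fun y => ?_
      rw [← mul_assoc, norm_mul, gs_J_apply, ← Complex.ofReal_mul, Complex.norm_real,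
        Complex.norm_real, Real.norm_of_nonneg (hG0 y)]
      exact mul_le_mul_of_nonneg_right (hbd k _) (hG0 y)
    · exact Eventually.of_forall fun y => hC.mul_right _
    · simp only [tsum_mul_right]
      exact hGint.const_mul _
    · refine Eventually.of_forall fun y => ?_
      have hs : Summable fun k => c k * (gsLap^[k] f) y.ofLp :=
        Summable.of_norm_bounded hC (fun k => hbd k _)
      have := Complex.hasSum_ofReal.mpr (hs.hasSum.mul_right (G y))
      refine this.congr_fun ?_ |> id
      intro k
      rw [gs_J_apply]; push_cast; ring
  -- second exchange
  have hB : HasSum (fun k => ∫ ξ : GsE n, (c k : ℂ) * (𝓕 (gsJ (gsLap^[k] f)) ξ *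
      Complex.exp (-((π / 2 : ℝ) : ℂ) * (‖ξ‖ : ℂ) ^ 2 + 2 * π * Complex.I * (inner ℝ X ξ : ℝ))))
      (∫ ξ : GsE n, 𝓕 (gsJ f) ξ * Complex.exp (2 * π * Complex.I * (inner ℝ X ξ : ℝ))) := by
    have hterm : ∀ (k : ℕ) (ξ : GsE n), (c k : ℂ) * (𝓕 (gsJ (gsLap^[k] f)) ξ *
        Complex.exp (-((π / 2 : ℝ) : ℂ) * (‖ξ‖ : ℂ) ^ 2 + 2 * π * Complex.I * (inner ℝ X ξ : ℝ))) =
        (((π / 2 * ‖ξ‖ ^ 2 : ℝ) ^ k / (Nat.factorial k : ℝ) : ℝ) : ℂ) * (𝓕 (gsJ f) ξ *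
        Complex.exp (-((π / 2 : ℝ) : ℂ) * (‖ξ‖ : ℂ) ^ 2 + 2 * π * Complex.I * (inner ℝ X ξ : ℝ))) := by
      intro k ξ
      have hpi : (π : ℂ) ≠ 0 := by exact_mod_cast Real.pi_ne_zero
      have e : (-(1 / (8 * (π : ℂ)))) * (-(4 * (π : ℂ) ^ 2 * (‖ξ‖ : ℂ) ^ 2)) =
          (π : ℂ) / 2 * (‖ξ‖ : ℂ) ^ 2 := by
        field_simp; ring
      rw [gs_fourier_lap_iter, hc]
      push_cast
      rw [← e, mul_pow]
      ring
    simp only [hterm]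
    have hexp : ∀ ξ : GsE n, HasSum (fun k : ℕ => (π / 2 * ‖ξ‖ ^ 2 : ℝ) ^ k / (Nat.factorial k : ℝ))
        (Real.exp (π / 2 * ‖ξ‖ ^ 2)) := fun ξ => by
      rw [Real.exp_eq_exp_ℝ]
      exact NormedSpace.expSeries_div_hasSum_exp _
    have hone : ∀ ξ : GsE n, Real.exp (π / 2 * ‖ξ‖ ^ 2) * (‖𝓕 (gsJ f) ξ‖ *
        Real.exp (-(π / 2) * ‖ξ‖ ^ 2)) = ‖𝓕 (gsJ f) ξ‖ := fun ξ => by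
      rw [mul_left_comm, ← Real.exp_add]
      simp
    refine hasSum_integral_of_dominated_convergence
      (fun k ξ => (π / 2 * ‖ξ‖ ^ 2 : ℝ) ^ k / (Nat.factorial k : ℝ) * (‖𝓕 (gsJ f) ξ‖ *
        Real.exp (-(π / 2) * ‖ξ‖ ^ 2))) ?_ ?_ ?_ ?_ ?_
    · intro k
      have := (𝓕 (gsJ f)).continuous
      exact Continuous.aestronglyMeasurable (by fun_prop)
    · intro k
      refine Eventually.of_forall fun ξ => ?_
      rw [norm_mul, norm_mul, gs_gauss_norm, Complex.norm_real, Real.norm_of_nonneg (by positivity)]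
    · exact Eventually.of_forall fun ξ => (hexp ξ).summable.mul_right _
    · simp only [tsum_mul_right, (hexp _).tsum_eq, hone]
      exact (𝓕 (gsJ f)).integrable.norm
    · refine Eventually.of_forall fun ξ => ?_
      have := (Complex.hasSum_ofReal.mpr (hexp ξ)).mul_right (𝓕 (gsJ f) ξ *
        Complex.exp (-((π / 2 : ℝ) : ℂ) * (‖ξ‖ : ℂ) ^ 2 + 2 * π * Complex.I * (inner ℝ X ξ : ℝ)))
      refine (congrArg (HasSum _) ?_).mpr this
      rw [mul_left_comm, Complex.ofReal_exp, ← Complex.exp_add]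
      congr 2
      push_cast
      ring
  have hAB := hA.unique (by
    convert hB using 2 with k
    rw [integral_const_mul, integral_const_mul, gs_heat_fourier])
  rw [gs_inversion, gs_J_apply, integral_complex_ofReal, Complex.ofReal_inj] at hAB
  rw [show f x = f X.ofLp from rfl, ← hAB, ← integral_const_mul,
    ← (PiLp.volume_preserving_ofLp (Fin n)).integral_comp
      (MeasurableEquiv.toLp 2 (Fin n → ℝ)).symm.measurableEmbedding]
  refine integral_congr_ae (Eventually.of_forall fun y => ?_)
  simp only [hG, EuclideanSpace.norm_sq_eq]
  simp [hX]
  ring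

theorem gs_final (n : ℕ) (lam mu : ℝ) (hlam : 0 < lam)
    (hmu0 : 0 < mu) (hmu : mu < 1 / 2) (v : (Fin n → ℝ) → ℝ) (hv : ContDiff ℝ (⊤ : ℕ∞) v)
    (A : ℝ) (hA : 1 ≤ A)
    (hbound : ∀ (α : Fin n → ℕ) (l : List (Fin n)) (x : Fin n → ℝ),
      |(∏ i, x i ^ α i) * pderivList l v x| ≤
        A ^ (∑ i, α i + l.length) * (∏ i, (Nat.factorial (α i) : ℝ)) ^ lam *
          (∏ i, (Nat.factorial (l.count i) : ℝ)) ^ mu) :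
    ∃ Φ : SchwartzMap (Fin n → ℝ) ℝ, ∀ x : Fin n → ℝ,
      v x = (2 : ℝ) ^ ((n : ℝ) / 2) *
        ∫ y : Fin n → ℝ, Φ y * Real.exp (-2 * Real.pi * ∑ i, (x i - y i) ^ 2) := by
  have hA0 : 0 < A := by linarith
  -- constants
  set a : ℕ → ℝ := fun m => A ^ m * (Nat.factorial m : ℝ) ^ lam with ha
  have ha0 : ∀ m, 0 ≤ a m := fun m => by positivity
  have ha1 : ∀ m, 1 ≤ a m := fun m => by
    refine one_le_mul_of_one_le_of_one_le (one_le_pow₀ hA) (Real.one_le_rpow ?_ hlam.le)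
    exact_mod_cast Nat.factorial_pos m
  have hb0 : ∀ (m : ℕ) (l : List (Fin n)) (x : Fin n → ℝ),
      |(∏ i, x i ^ (0 : Fin n → ℕ) i) * pderivList l v x| ≤
      a m * A ^ l.length * ((Nat.factorial l.length : ℕ) : ℝ) ^ mu := by
    intro m l x
    refine (hbound 0 l x).trans ?_
    simp only [Pi.zero_apply, Finset.sum_const_zero, zero_add, Nat.factorial_zero, Nat.cast_one,
      Finset.prod_const_one, Real.one_rpow, mul_one]
    have := gs_prod_factorial_le l
    calc _ ≤ A ^ l.length * ((Nat.factorial l.length : ℕ) : ℝ) ^ mu := by gcongr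
      _ ≤ a m * (A ^ l.length * ((Nat.factorial l.length : ℕ) : ℝ) ^ mu) :=
        le_mul_of_one_le_left (by positivity) (ha1 m)
      _ = _ := by ring
  have hb1 : ∀ (m : ℕ) (j : Fin n) (l : List (Fin n)) (x : Fin n → ℝ),
      |(∏ i, x i ^ (Pi.single j m : Fin n → ℕ) i) * pderivList l v x| ≤
      a m * A ^ l.length * ((Nat.factorial l.length : ℕ) : ℝ) ^ mu := by
    intro m j l x
    refine (hbound (Pi.single j m) l x).trans ?_
    have e1 : ∑ i, (Pi.single j m : Fin n → ℕ) i = m := by simp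
    have e2 : ∏ i, (Nat.factorial ((Pi.single j m : Fin n → ℕ) i) : ℝ) = (Nat.factorial m : ℝ) := by
      rw [Finset.prod_eq_single j]
      · simp
      · intro b _ hb; simp [hb]
      · simp
    rw [e1, e2, pow_add]
    have := gs_prod_factorial_le l
    calc _ ≤ A ^ m * A ^ l.length * (Nat.factorial m : ℝ) ^ lam *
          ((Nat.factorial l.length : ℕ) : ℝ) ^ mu := by gcongr
      _ = _ := by simp only [ha]; ring
  have hprod1 : ∀ (m : ℕ) (j : Fin n) (x : Fin n → ℝ),
      ∏ i, x i ^ (Pi.single j m : Fin n → ℕ) i = x j ^ m := by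
    intro m j x
    rw [Finset.prod_eq_single j]
    · simp
    · intro b _ hb; simp [hb]
    · simp
  -- v as a Schwartz function
  obtain ⟨f, hf⟩ : ∃ f : SchwartzMap (Fin n → ℝ) ℝ, ⇑f = v := by
    refine ⟨⟨v, hv, fun m j => ⟨_, gs_decay_of_bound hv m j
      (a m * A ^ j * ((Nat.factorial j : ℕ) : ℝ) ^ mu) ?_ ?_⟩⟩, rfl⟩
    · rintro l x rfl
      simpa using hb0 m l x
    · rintro l i x rfl
      simpa [hprod1] using hb1 m i l x
  set M : ℕ → ℕ → ℕ → ℝ := fun m j k => (n : ℝ) ^ k * (a m * A ^ (j + 2 * k) *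
        ((Nat.factorial (j + 2 * k) : ℕ) : ℝ) ^ mu) with hM
  have hdec : ∀ m j k x, ‖x‖ ^ m * ‖iteratedFDeriv ℝ j (gsLap^[k] f) x‖ ≤ (n : ℝ) ^ j * M m j k := by
    intro m j k x
    refine gs_decay_of_bound ((gsLap^[k] f).smooth ⊤) m j (M m j k) ?_ ?_ x
    · rintro l x rfl
      simpa using gs_lap_bound f 0 (a m) A mu (by rw [hf]; exact hb0 m) k l x
    · rintro l i x rfl
      simpa only [hprod1] using
        gs_lap_bound f (Pi.single i m) (a m) A mu (by rw [hf]; exact hb1 m i) k l x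
  set c : ℕ → ℝ := fun k => (-(1 / (8 * π))) ^ k / (Nat.factorial k : ℝ) with hc
  have hc1 : ∀ k, |c k| ≤ 1 / (Nat.factorial k : ℝ) := by
    intro k
    simp only [hc]
    rw [abs_div, abs_pow, abs_neg, Nat.abs_cast]
    gcongr
    apply pow_le_one₀ (abs_nonneg _)
    rw [abs_of_pos (by positivity), div_le_one (by positivity)]
    linarith [Real.pi_gt_three]
  set b : ℕ → ℕ → ℕ → ℝ := fun m j k => 1 / (Nat.factorial k : ℝ) * ((n : ℝ) ^ j * M m j k) with hb
  have hbs : ∀ m j, Summable (b m j) := by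
    intro m j
    have := (gs_summable j ((n : ℝ) * A ^ 2) mu (by positivity) hmu0 hmu).mul_left
      ((n : ℝ) ^ j * a m * A ^ j)
    refine this.congr fun k => ?_
    simp only [hb, hM]
    rw [mul_pow, pow_add, pow_mul]
    ring
  have hT : ∀ m j k x, ‖x‖ ^ m * ‖iteratedFDeriv ℝ j ⇑(c k • gsLap^[k] f) x‖ ≤ b m j k := by
    intro m j k x
    have : ⇑(c k • gsLap^[k] f) = c k • ⇑(gsLap^[k] f) := rfl
    rw [this, iteratedFDeriv_const_smul_apply (((gsLap^[k] f).smooth ⊤).contDiffAt.of_le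
      (by exact_mod_cast le_top)), norm_smul, mul_left_comm, Real.norm_eq_abs]
    exact mul_le_mul (hc1 k) (hdec m j k x) (by positivity) (by positivity)
  obtain ⟨Φ, hΦ⟩ := gs_tsum_schwartz (fun k => c k • gsLap^[k] f) b hbs hT
  refine ⟨Φ, fun x => ?_⟩
  have := gs_main f (b 0 0) (hbs 0 0) c (fun k => rfl) (fun k y => by
    simpa using hT 0 0 k y) x
  rw [hf] at this
  rw [this]
  simp only [hΦ, _root_.smul_apply, smul_eq_mul]

end helpers

theorem gelfand_shilov_in_heat_image (n : ℕ) (lam mu : ℝ) (hlam : 0 < lam)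
    (hmu0 : 0 < mu) (hmu : mu < 1 / 2) (v : (Fin n → ℝ) → ℝ) (hv : ContDiff ℝ (⊤ : ℕ∞) v)
    (A : ℝ) (hA : 0 < A)
    (hbound : ∀ (α : Fin n → ℕ) (l : List (Fin n)) (x : Fin n → ℝ),
      |(∏ i, x i ^ α i) * pderivList l v x| ≤
        A ^ (∑ i, α i + l.length) * (∏ i, (Nat.factorial (α i) : ℝ)) ^ lam *
          (∏ i, (Nat.factorial (l.count i) : ℝ)) ^ mu) :
    ∃ Φ : SchwartzMap (Fin n → ℝ) ℝ, ∀ x : Fin n → ℝ,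
      v x = (2 : ℝ) ^ ((n : ℝ) / 2) *
        ∫ y : Fin n → ℝ, Φ y * Real.exp (-2 * Real.pi * ∑ i, (x i - y i) ^ 2) := by
  refine gs_final n lam mu hlam hmu0 hmu v hv (max A 1) (le_max_right _ _) fun α l x => ?_
  refine (hbound α l x).trans ?_
  gcongr
  exact le_max_left _ _
end
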